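/- Let K be a scattered bisequential compact Hausdorff space and α < ω₁ an ordinal such that the α-th Cantor–Bendixson derivative K^(α) is nonempty. Then there exists a countable closed subset L ⊆ K with L^(α) ≠ ∅. -/

import Mathlib

open Filter Topology

/-- A sequence of sets `A n` converges to a point `x`. -/
def SetSeqTendsto {K : Type*} [TopologicalSpace K] (A : ℕ → Set K) (x : K) : Prop :=
  ∀ W ∈ 𝓝 x, ∃ n₀ : ℕ, ∀ n > n₀, A n ⊆ W

/-- A space is bisequential if every ultrafilter converging to a point `x` contains a
sequence of sets converging to `x`. -/
def Bisequential (K : Type*) [TopologicalSpace K] : Prop :=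
  ∀ (U : Ultrafilter K) (x : K), (U : Filter K) ≤ 𝓝 x →
    ∃ A : ℕ → Set K, (∀ n, A n ∈ U) ∧ SetSeqTendsto A x

/-- A space is scattered if every nonempty subset has a point isolated in it. -/
def Scattered (K : Type*) [TopologicalSpace K] : Prop :=
  ∀ s : Set K, s.Nonempty → ∃ x ∈ s, ∃ U : Set K, IsOpen U ∧ U ∩ s = {x}

/-- The `α`-th Cantor–Bendixson derivative of the space `X`, obtained by transfinitely
iterating removal of isolated points (at limits, intersections are taken). -/
noncomputable def cbDeriv (X : Type*) [TopologicalSpace X] (o : Ordinal.{0}) : Set X :=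
  Ordinal.limitRecOn o Set.univ
    (fun _ ih => {x | x ∈ ih ∧ x ∈ closure (ih \ {x})})
    (fun o _ ih => ⋂ (β : Ordinal.{0}) (h : β < o), ih β h)

theorem mem_cbDeriv_iff_aux {X : Type*} [TopologicalSpace X] (α : Ordinal.{0}) :
    ∀ x : X, x ∈ cbDeriv X α ↔ ∀ β < α, x ∈ closure (cbDeriv X β \ {x}) := by
  induction α using Ordinal.limitRecOn with
  | zero =>
    intro x
    simp [cbDeriv]
  | add_one a ih =>
    intro x
    have h : cbDeriv X (Order.succ a) =
        {x | x ∈ cbDeriv X a ∧ x ∈ closure (cbDeriv X a \ {x})} := by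
      unfold cbDeriv
      exact Ordinal.limitRecOn_succ _ _ _ _
    change x ∈ cbDeriv X (Order.succ a) ↔ ∀ β < Order.succ a, _
    rw [h, Set.mem_ofPred_eq, ih]
    constructor
    · rintro ⟨h1, h2⟩ β hβ
      rcases (Order.lt_succ_iff.1 hβ).lt_or_eq with h | h
      · exact h1 β h
      · subst h; exact h2
    · intro h
      exact ⟨fun β hβ => h β (hβ.trans (Order.lt_succ a)), h a (Order.lt_succ a)⟩
  | limit a ha ih =>
    intro x
    have h : cbDeriv X a = ⋂ (β : Ordinal.{0}) (_ : β < a), cbDeriv X β := by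
      unfold cbDeriv
      exact Ordinal.limitRecOn_limit _ _ _ _ ha
    rw [h]
    simp only [Set.mem_iInter]
    constructor
    · intro h1 β hβ
      have hs := ha.succ_lt hβ
      exact (ih _ hs x).1 (h1 _ hs) β (Order.lt_succ β)
    · intro h1 β hβ
      exact (ih β hβ x).2 fun γ hγ => h1 γ (hγ.trans hβ)

theorem cbDeriv_anti {X : Type*} [TopologicalSpace X] {α β : Ordinal.{0}} (h : β ≤ α) :
    cbDeriv X α ⊆ cbDeriv X β := fun x hx =>
  (mem_cbDeriv_iff_aux β x).2 fun γ hγ => (mem_cbDeriv_iff_aux α x).1 hx γ (hγ.trans_le h)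

theorem cbDeriv_map {X Y : Type*} [TopologicalSpace X] [TopologicalSpace Y] (f : X → Y)
    (hf : Continuous f) (hi : Function.Injective f) (α : Ordinal.{0}) :
    ∀ x ∈ cbDeriv X α, f x ∈ cbDeriv Y α := by
  induction α using WellFoundedLT.induction with
  | ind α ih =>
    intro x hx
    rw [mem_cbDeriv_iff_aux] at hx ⊢
    intro β hβ
    have h1 := image_closure_subset_closure_image hf (Set.mem_image_of_mem f (hx β hβ))
    refine closure_mono ?_ h1
    rintro _ ⟨z, ⟨hz, hzx⟩, rfl⟩
    exact ⟨ih β hβ z hz, fun h => hzx (hi h)⟩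

theorem key_claim {K : Type*} [TopologicalSpace K] [CompactSpace K]
    [T2Space K] (hbi : Bisequential K) (α : Ordinal.{0}) :
    α < (Cardinal.aleph 1).ord → ∀ x : K, ∃ U : Ultrafilter K, x ∈ cbDeriv K α →
      ((U : Filter K) ≤ 𝓝 x ∧ ∀ A ∈ U, ∃ L : Set K, L.Countable ∧ IsClosed L ∧
        L ⊆ closure A ∧ ∃ h : x ∈ L, (⟨x, h⟩ : L) ∈ cbDeriv L α) := by
  induction α using WellFoundedLT.induction with
  | ind α ih =>
  intro hα x
  by_cases h0 : α = 0
  · refine ⟨pure x, fun _ => ⟨pure_le_nhds x, fun A hA => ⟨{x}, Set.countable_singleton x,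
      isClosed_singleton, ?_, rfl, ?_⟩⟩⟩
    · rw [Set.singleton_subset_iff]
      exact subset_closure hA
    · subst h0
      rw [mem_cbDeriv_iff_aux]
      simp
  by_cases hx : x ∈ cbDeriv K α
  swap
  · exact ⟨pure x, fun h => absurd h hx⟩
  have hx' := (mem_cbDeriv_iff_aux α x).1 hx
  have ih' : ∀ p : Set.Iio α × K, ∃ U : Ultrafilter K, p.2 ∈ cbDeriv K p.1 →
      ((U : Filter K) ≤ 𝓝 p.2 ∧ ∀ A ∈ U, ∃ L : Set K, L.Countable ∧ IsClosed L ∧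
        L ⊆ closure A ∧ ∃ h : p.2 ∈ L, (⟨p.2, h⟩ : L) ∈ cbDeriv L p.1) := fun p =>
    ih p.1 p.1.2 (p.1.2.trans hα) p.2
  choose u hu using ih'
  have : Nonempty (Set.Iio α) := ⟨⟨0, pos_iff_ne_zero.2 h0⟩⟩
  let S : Set (Set.Iio α × K) := {p | p.2 ∈ cbDeriv K p.1 ∧ p.2 ≠ x}
  let F : Filter (Set.Iio α × K) := (atTop ×ˢ 𝓝 x) ⊓ 𝓟 S
  have hF : F.NeBot := by
    rw [← Filter.frequently_mem_iff_neBot]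
    rw [(atTop_basis.prod (𝓝 x).basis_sets).frequently_iff]
    rintro ⟨β, W⟩ ⟨-, hW⟩
    obtain ⟨y, hyW, hy⟩ := mem_closure_iff_nhds.1 (hx' β β.2) W hW
    exact ⟨(β, y), ⟨Set.mem_Ici.2 le_rfl, hyW⟩, hy.1, hy.2⟩
  let G : Filter K := F.bind fun p => (u p : Filter K)
  have hGx : G ≤ 𝓝 x := by
    intro W hW
    rw [Filter.mem_bind']
    have hW' := interior_mem_nhds.2 hW
    have h1 : ∀ᶠ p in F, p.2 ∈ interior W :=
      (tendsto_snd.mono_left inf_le_left : Tendsto Prod.snd F (𝓝 x)) hW'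
    have h2 : ∀ᶠ p in F, p ∈ S := mem_inf_of_right (mem_principal_self S)
    filter_upwards [h1, h2] with p hp1 hp2
    exact (hu p hp2.1).1 (mem_interior_iff_mem_nhds.1 hp1)
  have : G.NeBot := by
    rw [Filter.neBot_iff, Ne, ← Filter.empty_mem_iff_bot, Filter.mem_bind']
    intro h
    obtain ⟨p, hp⟩ := Filter.Eventually.exists (f := F) h
    exact (u p).empty_notMem hp
  have hUG := Ultrafilter.of_le G
  refine ⟨Ultrafilter.of G, fun _ => ⟨hUG.trans hGx, ?_⟩⟩
  set U := Ultrafilter.of G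
  have hfreq : ∀ A ∈ U, ∃ᶠ p in F, A ∈ u p := by
    intro A hA hcon
    have : Aᶜ ∈ G := by
      rw [Filter.mem_bind']
      filter_upwards [hcon] with p hp
      exact Ultrafilter.compl_mem_iff_notMem.2 hp
    exact Ultrafilter.compl_mem_iff_notMem.1 (hUG this) hA
  intro A hA
  obtain ⟨B, hBU, hBx⟩ := hbi U x (hUG.trans hGx)
  have hc : Countable (Set.Iio α) := by
    rw [← Cardinal.mk_le_aleph0_iff, Cardinal.mk_Iio_ordinal]
    rw [Cardinal.lt_ord, ← Cardinal.succ_aleph0, Order.lt_succ_iff] at hα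
    rw [Cardinal.lift_le_aleph0]
    exact hα
  obtain ⟨g, hg⟩ := exists_surjective_nat (Set.Iio α)
  have hex : ∀ n : ℕ, ∃ p : Set.Iio α × K, A ∩ B n ∈ u p ∧ p ∈ S ∧ g n.unpair.1 ≤ p.1 := by
    intro n
    have h1 := hfreq _ (Filter.inter_mem hA (hBU n))
    have h2 : ∀ᶠ p in F, p ∈ S := mem_inf_of_right (mem_principal_self S)
    have h3 : ∀ᶠ p in F, g n.unpair.1 ≤ p.1 :=
      (tendsto_fst.mono_left inf_le_left : Tendsto Prod.fst F atTop) (mem_atTop _)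
    obtain ⟨p, hp⟩ := (h1.and_eventually (h2.and h3)).exists
    exact ⟨p, hp⟩
  choose p hpA hpS hpg using hex
  choose M hMc hMcl hMA hpM hpD using fun n => (hu (p n) (hpS n).1).2 _ (hpA n)
  have hconv : ∀ W ∈ 𝓝 x, IsClosed W → ∃ n₀ : ℕ, ∀ n > n₀, M n ⊆ W := by
    intro W hW hWc
    obtain ⟨n₀, hn⟩ := hBx W hW
    refine ⟨n₀, fun n hn' => (hMA n).trans ?_⟩
    exact closure_minimal (Set.inter_subset_right.trans (hn n hn')) hWc
  refine ⟨{x} ∪ ⋃ n, M n, (Set.countable_singleton x).union (Set.countable_iUnion hMc),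
    ?_, ?_, Or.inl rfl, ?_⟩
  · rw [← closure_subset_iff_isClosed]
    intro z hz
    by_contra hzL
    have hzx : z ≠ x := fun h => hzL (Or.inl h)
    obtain ⟨W, hW, hWc, hWz⟩ := exists_mem_nhds_isClosed_subset
      (isOpen_compl_singleton.mem_nhds (show x ∈ ({z} : Set K)ᶜ from fun h => hzx h.symm))
    obtain ⟨n₀, hn⟩ := hconv W hW hWc
    have hcl : IsClosed (W ∪ ⋃ n ∈ Set.Iic n₀, M n) :=
      hWc.union ((Set.finite_Iic n₀).isClosed_biUnion fun n _ => hMcl n)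
    have hsub : ({x} ∪ ⋃ n, M n) ⊆ W ∪ ⋃ n ∈ Set.Iic n₀, M n := by
      rintro y (rfl | hy)
      · exact Or.inl (mem_of_mem_nhds hW)
      · obtain ⟨n, hy⟩ := Set.mem_iUnion.1 hy
        rcases le_or_gt n n₀ with h | h
        · exact Or.inr (Set.mem_biUnion (show n ∈ Set.Iic n₀ from h) hy)
        · exact Or.inl (hn n h hy)
    rcases closure_minimal hsub hcl hz with h | h
    · exact hWz h rfl
    · obtain ⟨n, -, hn⟩ := Set.mem_iUnion₂.1 h
      exact hzL (Or.inr (Set.mem_iUnion.2 ⟨n, hn⟩))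
  · rintro y (rfl | hy)
    · rw [mem_closure_iff_ultrafilter]
      exact ⟨U, hA, hUG.trans hGx⟩
    · obtain ⟨n, hy⟩ := Set.mem_iUnion.1 hy
      exact closure_mono Set.inter_subset_left (hMA n hy)
  · rw [mem_cbDeriv_iff_aux]
    intro β hβ
    rw [closure_subtype, mem_closure_iff_nhds]
    intro W hW
    obtain ⟨W', hW', hWc, hWW⟩ := exists_mem_nhds_isClosed_subset hW
    obtain ⟨n₀, hn⟩ := hconv W' hW' hWc
    obtain ⟨i, hi⟩ := hg ⟨β, hβ⟩
    let n := Nat.pair i (n₀ + 1)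
    have hnn : n > n₀ := Nat.right_le_pair i (n₀ + 1)
    have hsub : M n ⊆ {x} ∪ ⋃ n, M n := fun y hy => Or.inr (Set.mem_iUnion.2 ⟨n, hy⟩)
    have hle : β ≤ (p n).1 := by
      have := hpg n
      simp only [n, Nat.unpair_pair, hi] at this
      exact this
    refine ⟨(p n).2, hWW (hn n hnn (hpM n)), ⟨(p n).2, hsub (hpM n)⟩, ⟨?_, ?_⟩, rfl⟩
    · exact cbDeriv_anti hle (cbDeriv_map (Set.inclusion hsub) (continuous_inclusion hsub)
        (Set.inclusion_injective hsub) _ _ (hpD n))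
    · intro h
      exact (hpS n).2 (congrArg Subtype.val h)

/-- If `K` is a scattered bisequential compact Hausdorff space and `α < ω₁` is such that
`K^(α) ≠ ∅`, then there is a countable closed `L ⊆ K` with `L^(α) ≠ ∅` (the derivative of
`L` being computed in the subspace `L`). -/
theorem scattered_countable_subset (K : Type*) [TopologicalSpace K] [CompactSpace K]
    [T2Space K] (hsc : Scattered K) (hbi : Bisequential K)
    (α : Ordinal.{0}) (hα : α < (Cardinal.aleph 1).ord)
    (hne : (cbDeriv K α).Nonempty) :
    ∃ L : Set K, L.Countable ∧ IsClosed L ∧ (cbDeriv (↥L) α).Nonempty := by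
  obtain ⟨x, hx⟩ := hne
  obtain ⟨U, hU⟩ := key_claim hbi α hα x
  obtain ⟨L, hLc, hLcl, -, h, hL⟩ := (hU hx).2 Set.univ Filter.univ_mem
  exact ⟨L, hLc, hLcl, _, hL⟩
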